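/- Let |ψ⟩ be a fully entangled stabilizer state on n ≥ 3 qubits such that there exist minimal supports ω₁, ω₂, … of 𝒮(ψ) with A_{ω₁}(ψ) = A_{ω₂}(ψ) = ⋯ = 3, whose union covers {1,…,n} (every qubit index belongs to at least one ω_j). Then LU(ψ) = LC(ψ). -/

import Mathlib

open Matrix

noncomputable section

/-- Pauli matrices: `0 ↦ σ₀` (identity), `1 ↦ σₓ`, `2 ↦ σ_y`, `3 ↦ σ_z`. -/
def pauliMat : Fin 4 → Matrix (Fin 2) (Fin 2) ℂ :=
  ![1, !![0, 1; 1, 0], !![0, -Complex.I; Complex.I, 0], !![1, 0; 0, -1]]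

/-- Tensor (Kronecker) product of a family of one-qubit operators, as an operator
on qubits indexed by `ι`. -/
def kron {ι : Type} [Fintype ι] (U : ι → Matrix (Fin 2) (Fin 2) ℂ) :
    Matrix (ι → Fin 2) (ι → Fin 2) ℂ :=
  Matrix.of fun x y => ∏ i, U i (x i) (y i)

/-- An element of the Pauli group: a phase in `{1, -1, i, -i}` together with a
Pauli label (`σ₀, σₓ, σ_y, σ_z`) on every qubit. -/
structure PauliOp (ι : Type) where
  phase : ℂ
  label : ι → Fin 4
  phase_ok : phase = 1 ∨ phase = -1 ∨ phase = Complex.I ∨ phase = -Complex.I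

noncomputable instance {ι : Type} : DecidableEq (PauliOp ι) := Classical.decEq _

/-- The matrix of a Pauli group element. -/
def PauliOp.toMatrix {ι : Type} [Fintype ι] (M : PauliOp ι) :
    Matrix (ι → Fin 2) (ι → Fin 2) ℂ :=
  M.phase • kron fun i => pauliMat (M.label i)

/-- The support of a Pauli operator: the set of qubits on which it acts nontrivially. -/
def PauliOp.support {ι : Type} [Fintype ι] [DecidableEq ι] (M : PauliOp ι) : Finset ι :=
  Finset.univ.filter fun i => M.label i ≠ 0

/-- A (maximal) stabilizer on the qubits indexed by `ι`: an abelian subgroup of the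
Pauli group of cardinality `2^|ι|` which does not contain `-I`. -/
structure Stabilizer (ι : Type) [Fintype ι] [DecidableEq ι] where
  elems : Finset (PauliOp ι)
  one_mem : ∃ M ∈ elems, PauliOp.toMatrix M = 1
  mul_mem : ∀ M ∈ elems, ∀ N ∈ elems, ∃ K ∈ elems,
    PauliOp.toMatrix K = PauliOp.toMatrix M * PauliOp.toMatrix N
  comm : ∀ M ∈ elems, ∀ N ∈ elems,
    PauliOp.toMatrix M * PauliOp.toMatrix N = PauliOp.toMatrix N * PauliOp.toMatrix M
  neg_one_not_mem : ∀ M ∈ elems, PauliOp.toMatrix M ≠ -1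
  card_elems : elems.card = 2 ^ Fintype.card ι

variable {ι : Type} [Fintype ι] [DecidableEq ι]

/-- `ψ` is the stabilizer state of the stabilizer `S`: it is a unit vector fixed by
every element of `S`. -/
def stabilizesState (S : Stabilizer ι) (ψ : (ι → Fin 2) → ℂ) : Prop :=
  (∑ x, Complex.normSq (ψ x)) = 1 ∧ ∀ M ∈ S.elems, (PauliOp.toMatrix M).mulVec ψ = ψ

/-- `ψ` is a stabilizer state. -/
def IsStabilizerState (ψ : (ι → Fin 2) → ℂ) : Prop :=
  ∃ S : Stabilizer ι, stabilizesState S ψ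

/-- `A_ω(ψ)`: the number of stabilizer elements with support exactly `ω`. -/
def Aomega (S : Stabilizer ι) (ω : Finset ι) : ℕ :=
  (S.elems.filter fun M => PauliOp.support M = ω).card

/-- `ω` is a minimal support of `S`: it is the support of some element of `S`, and no
element of `S` has nonempty support strictly contained in `ω`. -/
def IsMinimalSupport (S : Stabilizer ι) (ω : Finset ι) : Prop :=
  (∃ M ∈ S.elems, PauliOp.support M = ω) ∧
    ∀ M ∈ S.elems, PauliOp.support M ⊂ ω → PauliOp.support M = ∅

/-- The matrices of the minimal elements of `S` (the elements whose support is a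
minimal support). -/
def minimalMatrices (S : Stabilizer ι) : Set (Matrix (ι → Fin 2) (ι → Fin 2) ℂ) :=
  {A | ∃ M ∈ S.elems, IsMinimalSupport S (PauliOp.support M) ∧ PauliOp.toMatrix M = A}

/-- `M` belongs to the subgroup `ℳ(ψ)` of `S` generated by the minimal elements.
(Every stabilizer element is an involution, so the generated submonoid coincides with
the generated subgroup.) -/
def inMinimalSubgroup (S : Stabilizer ι) (M : PauliOp ι) : Prop :=
  M ∈ S.elems ∧ PauliOp.toMatrix M ∈ Submonoid.closure (minimalMatrices S)

/-- A one-qubit Clifford operation: a unitary mapping each of the three Pauli matrices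
to a Pauli matrix, up to sign, under conjugation. -/
def IsClifford (U : Matrix (Fin 2) (Fin 2) ℂ) : Prop :=
  U ∈ Matrix.unitaryGroup (Fin 2) ℂ ∧
    ∃ π : Equiv.Perm (Fin 3), ∀ u : Fin 3, ∃ s : ℂ, (s = 1 ∨ s = -1) ∧
      U * pauliMat u.succ * Uᴴ = s • pauliMat (π u).succ

/-- Local unitary equivalence of pure states. -/
def LUequiv (ψ φ : (ι → Fin 2) → ℂ) : Prop :=
  ∃ U : ι → Matrix (Fin 2) (Fin 2) ℂ,
    (∀ i, U i ∈ Matrix.unitaryGroup (Fin 2) ℂ) ∧ (kron U).mulVec ψ = φ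

/-- Local Clifford equivalence of pure states. -/
def LCequiv (ψ φ : (ι → Fin 2) → ℂ) : Prop :=
  ∃ U : ι → Matrix (Fin 2) (Fin 2) ℂ,
    (∀ i, IsClifford (U i)) ∧ (kron U).mulVec ψ = φ

/-- Local Clifford equivalence of (possibly mixed) states. -/
def LCequivMixed (ρ ρ' : Matrix (ι → Fin 2) (ι → Fin 2) ℂ) : Prop :=
  ∃ U : ι → Matrix (Fin 2) (Fin 2) ℂ,
    (∀ i, IsClifford (U i)) ∧ kron U * ρ * (kron U)ᴴ = ρ'

/-- A pure state is fully entangled if it is not a tensor product of states on two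
complementary nonempty subsets of the qubits. -/
def FullyEntangled (ψ : (ι → Fin 2) → ℂ) : Prop :=
  ¬ ∃ (ω : Finset ι) (φ : ({i // i ∈ ω} → Fin 2) → ℂ) (χ : ({i // i ∉ ω} → Fin 2) → ℂ),
      ω ≠ ∅ ∧ ω ≠ Finset.univ ∧
        ∀ x : ι → Fin 2, ψ x = φ (fun i => x i.1) * χ (fun i => x i.1)

/-- Recombine an assignment on `ω` and one on its complement into a global assignment. -/
def mergeAssign (ω : Finset ι) (x : {i // i ∈ ω} → Fin 2) (z : {i // i ∉ ω} → Fin 2) :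
    ι → Fin 2 :=
  fun i => if h : i ∈ ω then x ⟨i, h⟩ else z ⟨i, h⟩

/-- The reduced density matrix `ρ_ω(ψ)` of the pure state `ψ` on the qubits in `ω`
(partial trace of `|ψ⟩⟨ψ|` over the qubits outside `ω`). -/
def reducedState (ψ : (ι → Fin 2) → ℂ) (ω : Finset ι) :
    Matrix ({i // i ∈ ω} → Fin 2) ({i // i ∈ ω} → Fin 2) ℂ :=
  Matrix.of fun x y =>
    ∑ z : {i // i ∉ ω} → Fin 2, ψ (mergeAssign ω x z) * (starRingEnd ℂ) (ψ (mergeAssign ω y z))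

/-- The restriction `α_M M_{i₁} ⊗ ⋯ ⊗ M_{i_k}` of a Pauli operator to the qubits in `ω`. -/
def PauliOp.restrict (M : PauliOp ι) (ω : Finset ι) :
    Matrix ({i // i ∈ ω} → Fin 2) ({i // i ∈ ω} → Fin 2) ℂ :=
  M.phase • kron fun i : {i // i ∈ ω} => pauliMat (M.label i.1)

/-- The `n`-qubit GHZ state `(|0…0⟩ + |1…1⟩)/√2`. -/
def ghz (n : ℕ) : (Fin n → Fin 2) → ℂ :=
  fun x => if x = (fun _ => 0) ∨ x = (fun _ => 1) then ((Real.sqrt 2 : ℝ)⁻¹ : ℂ) else 0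

/-- The `2n × 2n` binary symplectic form `P = [[0, I], [I, 0]]`. -/
def Pmat (n : ℕ) : Matrix (Fin n ⊕ Fin n) (Fin n ⊕ Fin n) (ZMod 2) :=
  Matrix.fromBlocks 0 1 1 0

end

section Auxiliary

variable {ι : Type} [Fintype ι]

theorem kron_conjTranspose (A : ι → Matrix (Fin 2) (Fin 2) ℂ) :
    (kron A)ᴴ = kron fun i => (A i)ᴴ := by
  ext x y
  simp [kron, Matrix.conjTranspose_apply]

theorem kron_one : kron (fun _ : ι => (1 : Matrix (Fin 2) (Fin 2) ℂ)) = 1 := by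
  ext x y
  simp only [kron, Matrix.of_apply, Matrix.one_apply, Finset.prod_ite_zero, funext_iff]
  simp

/-- The set of qubits on which a Pauli string acts nontrivially. -/
def labelSupport (Q : ι → Fin 4) : Finset ι := Finset.univ.filter fun i => Q i ≠ 0

theorem mem_labelSupport {Q : ι → Fin 4} {i : ι} : i ∈ labelSupport Q ↔ Q i ≠ 0 := by
  simp [labelSupport]

variable [DecidableEq ι]

theorem kron_mul_kron (A B : ι → Matrix (Fin 2) (Fin 2) ℂ) :
    kron A * kron B = kron fun i => A i * B i := by
  ext x y
  simp only [kron, Matrix.mul_apply, Matrix.of_apply, ← Finset.prod_mul_distrib,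
    Finset.prod_univ_sum, Fintype.piFinset_univ]

/-- The expectation value of a product observable `⊗ᵢ Aᵢ` in the state `ψ`. -/
noncomputable def expVal (ψ : (ι → Fin 2) → ℂ) (A : ι → Matrix (Fin 2) (Fin 2) ℂ) : ℂ :=
  star ψ ⬝ᵥ (kron A *ᵥ ψ)

theorem expVal_eq_sum (ψ : (ι → Fin 2) → ℂ) (A : ι → Matrix (Fin 2) (Fin 2) ℂ) :
    expVal ψ A = ∑ x, ∑ y, star (ψ x) * ((∏ i, A i (x i) (y i)) * ψ y) := by
  simp [expVal, dotProduct, Matrix.mulVec, kron, Finset.mul_sum]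

/-- The expectation value of a Pauli string. -/
noncomputable def pauliExp (ψ : (ι → Fin 2) → ℂ) (Q : ι → Fin 4) : ℂ :=
  expVal ψ fun i => pauliMat (Q i)

theorem expVal_kron_mulVec (U : ι → Matrix (Fin 2) (Fin 2) ℂ) (ψ : (ι → Fin 2) → ℂ)
    (A : ι → Matrix (Fin 2) (Fin 2) ℂ) :
    expVal (kron U *ᵥ ψ) A = expVal ψ fun i => (U i)ᴴ * A i * U i := by
  rw [expVal, expVal, Matrix.star_mulVec, ← Matrix.dotProduct_mulVec, Matrix.mulVec_mulVec,
    Matrix.mulVec_mulVec, kron_conjTranspose, kron_mul_kron, kron_mul_kron]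

theorem expVal_eq_sum_pauliExp (ψ : (ι → Fin 2) → ℂ) (A : ι → Matrix (Fin 2) (Fin 2) ℂ)
    (w : ι → Fin 4 → ℂ) (hA : ∀ i, A i = ∑ p, w i p • pauliMat p) :
    expVal ψ A = ∑ P : ι → Fin 4, (∏ i, w i (P i)) * pauliExp ψ P := by
  have h : kron A = ∑ P : ι → Fin 4, (∏ i, w i (P i)) • kron fun i => pauliMat (P i) := by
    ext x y
    simp only [kron, Matrix.of_apply, hA, Matrix.sum_apply, Matrix.smul_apply, smul_eq_mul,
      ← Finset.prod_mul_distrib, Finset.prod_univ_sum, Fintype.piFinset_univ]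
  simp only [pauliExp, expVal, h, Matrix.sum_mulVec, dotProduct_sum, Matrix.smul_mulVec,
    dotProduct_smul, smul_eq_mul]

theorem exists_pauliMat_mul (a b : Fin 4) :
    ∃ c : ℂ, pauliMat a * pauliMat b = c • pauliMat (a ^^^ b) := by
  fin_cases a <;> fin_cases b <;>
  first
  | (refine ⟨1, ?_⟩
     ext i j; fin_cases i <;> fin_cases j <;>
       simp [pauliMat, Matrix.mul_apply, Fin.sum_univ_two]
     done)
  | (refine ⟨Complex.I, ?_⟩
     ext i j; fin_cases i <;> fin_cases j <;>
       simp [pauliMat, Matrix.mul_apply, Fin.sum_univ_two]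
     done)
  | (refine ⟨-Complex.I, ?_⟩
     ext i j; fin_cases i <;> fin_cases j <;>
       simp [pauliMat, Matrix.mul_apply, Fin.sum_univ_two])

theorem trace_pauliMat_mul (a b : Fin 4) :
    (pauliMat a * pauliMat b).trace = if a = b then 2 else 0 := by
  fin_cases a <;> fin_cases b <;>
    simp [pauliMat, Matrix.trace, Fin.sum_univ_two] <;> norm_num

theorem eq_sum_pauliMat (A : Matrix (Fin 2) (Fin 2) ℂ) :
    A = ∑ p, ((pauliMat p * A).trace / 2) • pauliMat p := by
  ext i j
  fin_cases i <;> fin_cases j <;>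
    simp [pauliMat, Matrix.mul_apply, Matrix.trace, Fin.sum_univ_four, Fin.sum_univ_two] <;>
    ring_nf <;> simp <;> ring

theorem sum_pauliMat_mul_star (a b c d : Fin 2) :
    ∑ q, pauliMat q a b * star (pauliMat q c d) = if b = d ∧ c = a then 2 else 0 := by
  fin_cases a <;> fin_cases b <;> fin_cases c <;> fin_cases d <;>
    simp [pauliMat, Fin.sum_univ_four] <;> norm_num

theorem sum_normSq_pauliExp (ψ : (ι → Fin 2) → ℂ) (ω : Finset ι) :
    ∑ Q : ι → Fin 4 with ∀ l, l ∉ ω → Q l = 0, pauliExp ψ Q * star (pauliExp ψ Q) =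
      2 ^ ω.card * ∑ x, ∑ y, star (ψ x * ψ y) * (ψ (ω.piecewise x y) * ψ (ω.piecewise y x)) := by
  have h1 : ∀ x y x' y' : ι → Fin 2,
      ∑ Q : ι → Fin 4 with ∀ l, l ∉ ω → Q l = 0,
        (∏ i, pauliMat (Q i) (x i) (y i)) * star (∏ i, pauliMat (Q i) (x' i) (y' i)) =
      if y = ω.piecewise y' x ∧ x' = ω.piecewise x y' then 2 ^ ω.card else 0 := by
    intro x y x' y'
    have h2 : ∀ i, (∑ q : Fin 4, (if i ∉ ω → q = 0 then (1 : ℂ) else 0) *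
        (pauliMat q (x i) (y i) * star (pauliMat q (x' i) (y' i)))) =
        if y i = ω.piecewise y' x i ∧ x' i = ω.piecewise x y' i then
          (if i ∈ ω then 2 else 1) else 0 := by
      intro i
      by_cases hi : i ∈ ω
      · simp only [hi, not_true_eq_false, false_imp_iff, if_true, one_mul, sum_pauliMat_mul_star,
          Finset.piecewise_eq_of_mem]
      · simp [hi, pauliMat, Matrix.one_apply, eq_comm]
        split_ifs <;> simp_all
    rw [Finset.sum_filter]
    calc _ = ∑ Q : ι → Fin 4, ∏ i, ((if i ∉ ω → Q i = 0 then (1 : ℂ) else 0) *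
        (pauliMat (Q i) (x i) (y i) * star (pauliMat (Q i) (x' i) (y' i)))) := by
          refine Finset.sum_congr rfl fun Q _ => ?_
          rw [Finset.prod_mul_distrib, Finset.prod_mul_distrib, Finset.prod_ite_zero, star_prod]
          simp
      _ = ∏ i, ∑ q : Fin 4, ((if i ∉ ω → q = 0 then (1 : ℂ) else 0) *
        (pauliMat q (x i) (y i) * star (pauliMat q (x' i) (y' i)))) := by
          rw [Finset.prod_univ_sum, Fintype.piFinset_univ]
      _ = _ := by
          rw [Finset.prod_congr rfl fun i _ => h2 i, Finset.prod_ite_zero]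
          simp only [Finset.mem_univ, true_imp_iff, forall_and, funext_iff,
            Finset.prod_ite, Finset.prod_const, one_pow, mul_one, Finset.filter_mem_eq_inter,
            Finset.univ_inter]
  calc _ = ∑ Q : ι → Fin 4 with ∀ l, l ∉ ω → Q l = 0, ∑ x, ∑ y', ∑ y, ∑ x',
        (star (ψ x * ψ y') * (ψ x' * ψ y)) *
        ((∏ i, pauliMat (Q i) (x i) (y i)) * star (∏ i, pauliMat (Q i) (x' i) (y' i))) := by
        refine Finset.sum_congr rfl fun Q _ => ?_
        rw [pauliExp, expVal_eq_sum, star_sum, Finset.sum_mul]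
        refine Finset.sum_congr rfl fun x _ => ?_
        trans ∑ y, ∑ y', ∑ x', (star (ψ x * ψ y') * (ψ x' * ψ y)) *
          ((∏ i, pauliMat (Q i) (x i) (y i)) * star (∏ i, pauliMat (Q i) (x' i) (y' i)))
        · rw [Finset.sum_mul]
          refine Finset.sum_congr rfl fun y _ => ?_
          rw [Finset.mul_sum, Finset.sum_comm]
          refine Finset.sum_congr rfl fun x' _ => ?_
          rw [star_sum, Finset.mul_sum]
          refine Finset.sum_congr rfl fun y' _ => ?_
          simp only [star_mul', star_star]
          ring
        · rw [Finset.sum_comm]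
    _ = ∑ x, ∑ y', ∑ y, ∑ x', (star (ψ x * ψ y') * (ψ x' * ψ y)) *
          if y = ω.piecewise y' x ∧ x' = ω.piecewise x y' then 2 ^ ω.card else 0 := by
        simp only [← h1, Finset.mul_sum]
        rw [Finset.sum_comm]
        refine Finset.sum_congr rfl fun x _ => ?_
        rw [Finset.sum_comm]
        refine Finset.sum_congr rfl fun y' _ => ?_
        rw [Finset.sum_comm]
        refine Finset.sum_congr rfl fun y _ => ?_
        rw [Finset.sum_comm]
    _ = _ := by
        rw [Finset.mul_sum]
        refine Finset.sum_congr rfl fun x _ => ?_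
        rw [Finset.mul_sum]
        refine Finset.sum_congr rfl fun y' _ => ?_
        simp only [ite_and, mul_ite, mul_zero, Finset.sum_ite_eq',
          Finset.mem_univ, if_true, Finset.sum_const_zero, Finset.sum_ite_irrel]
        ring

theorem sum_normSq_pauliExp_univ {ψ : (ι → Fin 2) → ℂ} (hψ : ∑ x, Complex.normSq (ψ x) = 1) :
    ∑ Q, Complex.normSq (pauliExp ψ Q) = 2 ^ Fintype.card ι := by
  have h := sum_normSq_pauliExp ψ Finset.univ
  have h2 : ∑ x, ∑ y, star (ψ x * ψ y) * (ψ x * ψ y) = 1 := by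
    have h3 : ((∑ x, Complex.normSq (ψ x) : ℝ) : ℂ) * (∑ y, Complex.normSq (ψ y) : ℝ) = 1 := by
      simp [hψ]
    push_cast at h3
    rw [Finset.sum_mul_sum] at h3
    rw [← h3]
    refine Finset.sum_congr rfl fun x _ => Finset.sum_congr rfl fun y _ => ?_
    rw [Complex.normSq_eq_conj_mul_self, Complex.normSq_eq_conj_mul_self, star_mul']
    simp only [← starRingEnd_apply]
    ring
  simp only [Finset.mem_univ, not_true_eq_false, false_imp_iff, implies_true,
    Finset.filter_true, Finset.piecewise_univ, h2, mul_one, Finset.card_univ] at h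
  simp only [← starRingEnd_apply, Complex.mul_conj] at h
  exact_mod_cast h

/-- A state that is pure on `ω` satisfies the exchange identity of a product state. -/
theorem mul_eq_piecewise_mul {ψ : (ι → Fin 2) → ℂ} (hψ : ∑ x, Complex.normSq (ψ x) = 1)
    {ω : Finset ι}
    (h : 2 ^ ω.card ≤ ∑ Q : ι → Fin 4 with ∀ l, l ∉ ω → Q l = 0, Complex.normSq (pauliExp ψ Q))
    (x y : ι → Fin 2) : ψ x * ψ y = ψ (ω.piecewise x y) * ψ (ω.piecewise y x) := by
  set F : (ι → Fin 2) × (ι → Fin 2) → ℂ := fun p => ψ p.1 * ψ p.2 with hF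
  set m : (ι → Fin 2) × (ι → Fin 2) → (ι → Fin 2) × (ι → Fin 2) :=
    fun p => (ω.piecewise p.1 p.2, ω.piecewise p.2 p.1) with hm
  have hmm : Function.Involutive m := by
    rintro ⟨x, y⟩
    ext i <;> by_cases hi : i ∈ ω <;> simp [m, hi]
  have h1 : ∑ p, Complex.normSq (F p) = 1 := by
    simp only [hF, map_mul, Fintype.sum_prod_type, ← Finset.sum_mul_sum, hψ, mul_one]
  have h2 : ∑ p, Complex.normSq (F (m p)) = 1 := by
    rw [← h1]
    exact Equiv.sum_comp (hmm.toPerm m) fun p => Complex.normSq (F p)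
  have h3 : ((∑ Q : ι → Fin 4 with ∀ l, l ∉ ω → Q l = 0, Complex.normSq (pauliExp ψ Q) : ℝ) : ℂ)
      = ((2 ^ ω.card : ℝ) : ℂ) * ∑ p, star (F p) * F (m p) := by
    push_cast
    simp only [Fintype.sum_prod_type]
    rw [← sum_normSq_pauliExp]
    simp only [← starRingEnd_apply, Complex.mul_conj]
  have h4 := congrArg Complex.re h3
  rw [Complex.ofReal_re, Complex.re_ofReal_mul] at h4
  have h5 : 1 ≤ (∑ p, star (F p) * F (m p)).re := by
    have : (0 : ℝ) < 2 ^ ω.card := by positivity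
    nlinarith
  have h6 : ∑ p, Complex.normSq (F (m p) - F p) ≤ 0 := by
    have : ∀ p, Complex.normSq (F (m p) - F p) =
        Complex.normSq (F (m p)) + Complex.normSq (F p) - 2 * (star (F p) * F (m p)).re := by
      intro p
      rw [Complex.normSq_sub, mul_comm (star (F p))]
      rfl
    simp only [this, Finset.sum_add_distrib, Finset.sum_sub_distrib, h1, h2, ← Finset.mul_sum,
      ← Complex.re_sum]
    linarith
  have h7 := (Finset.sum_eq_zero_iff_of_nonneg fun p _ => Complex.normSq_nonneg _).1
    (h6.antisymm (Finset.sum_nonneg fun p _ => Complex.normSq_nonneg _)) (x, y) (Finset.mem_univ _)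
  rw [Complex.normSq_eq_zero, sub_eq_zero] at h7
  exact h7.symm

theorem FullyEntangled.sum_normSq_pauliExp_lt {ψ : (ι → Fin 2) → ℂ} (hent : FullyEntangled ψ)
    (hψ : ∑ x, Complex.normSq (ψ x) = 1) {ω : Finset ι} (h0 : ω ≠ ∅) (h1 : ω ≠ Finset.univ) :
    ∑ Q : ι → Fin 4 with ∀ l, l ∉ ω → Q l = 0, Complex.normSq (pauliExp ψ Q) < 2 ^ ω.card := by
  by_contra! h
  have hex := mul_eq_piecewise_mul hψ h
  obtain ⟨y, hy⟩ : ∃ y, ψ y ≠ 0 := by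
    by_contra! h
    simp [h] at hψ
  refine hent ⟨ω, fun a => ψ (fun i => if h : i ∈ ω then a ⟨i, h⟩ else y i) / ψ y,
    fun c => ψ (fun i => if h : i ∈ ω then y i else c ⟨i, h⟩), h0, h1, fun x => ?_⟩
  rw [div_mul_eq_mul_div, eq_div_iff hy, hex x y]
  rfl

section Stabilized

variable {S : Stabilizer ι} {ψ : (ι → Fin 2) → ℂ}

theorem star_dotProduct_self (hψ : stabilizesState S ψ) : star ψ ⬝ᵥ ψ = 1 := by
  have h := congrArg (fun r : ℝ => (r : ℂ)) hψ.1
  simpa [dotProduct, Complex.normSq_eq_conj_mul_self] using h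

theorem phase_mul_pauliExp (hψ : stabilizesState S ψ) {M : PauliOp ι} (hM : M ∈ S.elems) :
    M.phase * pauliExp ψ M.label = 1 := by
  have h := hψ.2 M hM
  rw [PauliOp.toMatrix, Matrix.smul_mulVec] at h
  rw [pauliExp, expVal, ← smul_eq_mul, ← dotProduct_smul, h, star_dotProduct_self hψ]

theorem normSq_pauliExp (hψ : stabilizesState S ψ) {M : PauliOp ι} (hM : M ∈ S.elems) :
    Complex.normSq (pauliExp ψ M.label) = 1 := by
  have h := congrArg Complex.normSq (phase_mul_pauliExp hψ hM)
  rw [map_mul, map_one] at h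
  rcases M.phase_ok with hp | hp | hp | hp <;> simpa [hp] using h

theorem injOn_label (hψ : stabilizesState S ψ) :
    Set.InjOn PauliOp.label (S.elems : Set (PauliOp ι)) := by
  intro M hM N hN h
  have h1 := phase_mul_pauliExp hψ hM
  have h2 := phase_mul_pauliExp hψ hN
  rw [← h] at h2
  have h3 : M.phase = N.phase := mul_right_cancel₀ (right_ne_zero_of_mul_eq_one h1) (h1.trans h2.symm)
  cases M
  cases N
  simp_all

theorem exists_mem_of_pauliExp_ne_zero (hψ : stabilizesState S ψ) {Q : ι → Fin 4}
    (hQ : pauliExp ψ Q ≠ 0) : ∃ M ∈ S.elems, M.label = Q := by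
  by_contra! h
  have h1 : Q ∉ S.elems.image PauliOp.label := by simpa using h
  have h2 : ∑ P ∈ S.elems.image PauliOp.label, Complex.normSq (pauliExp ψ P) =
      2 ^ Fintype.card ι := by
    rw [Finset.sum_image (injOn_label hψ), Finset.sum_congr rfl fun M hM => normSq_pauliExp hψ hM]
    simp [S.card_elems]
  have h3 := Finset.sum_le_univ_sum_of_nonneg (s := insert Q (S.elems.image PauliOp.label))
    fun P => Complex.normSq_nonneg (pauliExp ψ P)
  rw [Finset.sum_insert h1, h2, sum_normSq_pauliExp_univ hψ.1] at h3
  have := Complex.normSq_pos.2 hQ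
  linarith

theorem pauliExp_xor_ne_zero (hψ : stabilizesState S ψ) {P Q : ι → Fin 4}
    (hP : pauliExp ψ P ≠ 0) (hQ : pauliExp ψ Q ≠ 0) : pauliExp ψ (fun i => P i ^^^ Q i) ≠ 0 := by
  obtain ⟨M, hM, rfl⟩ := exists_mem_of_pauliExp_ne_zero hψ hP
  obtain ⟨N, hN, rfl⟩ := exists_mem_of_pauliExp_ne_zero hψ hQ
  choose c hc using exists_pauliMat_mul
  have h : (M.toMatrix * N.toMatrix) *ᵥ ψ = ψ := by
    rw [← Matrix.mulVec_mulVec, hψ.2 N hN, hψ.2 M hM]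
  have h2 : M.toMatrix * N.toMatrix = (M.phase * N.phase * ∏ i, c (M.label i) (N.label i)) •
      kron fun i => pauliMat (M.label i ^^^ N.label i) := by
    rw [PauliOp.toMatrix, PauliOp.toMatrix, Matrix.smul_mul, Matrix.mul_smul, kron_mul_kron,
      mul_smul, mul_smul]
    congr 2
    ext x y
    simp [kron, hc, Finset.prod_mul_distrib]
  rw [h2, Matrix.smul_mulVec] at h
  intro h0
  have h3 := congrArg (star ψ ⬝ᵥ ·) h
  simp only [dotProduct_smul, star_dotProduct_self hψ] at h3
  rw [pauliExp, expVal] at h0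
  simp [h0] at h3

end Stabilized

/-- The Bloch-sphere matrix of conjugation by `U`, in the Pauli basis. -/
noncomputable def blochMat (U : Matrix (Fin 2) (Fin 2) ℂ) (a u : Fin 4) : ℂ :=
  (pauliMat a * (U * pauliMat u * Uᴴ)).trace / 2

theorem conj_pauliMat (U : Matrix (Fin 2) (Fin 2) ℂ) (u : Fin 4) :
    U * pauliMat u * Uᴴ = ∑ a, blochMat U a u • pauliMat a :=
  eq_sum_pauliMat _

theorem blochMat_eq (U : Matrix (Fin 2) (Fin 2) ℂ) (a u : Fin 4) :
    blochMat U a u = (pauliMat u * (Uᴴ * pauliMat a * U)).trace / 2 := by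
  rw [blochMat, ← mul_assoc, Matrix.trace_mul_comm, ← mul_assoc, ← mul_assoc,
    Matrix.trace_mul_comm]

theorem conjTranspose_conj_pauliMat (U : Matrix (Fin 2) (Fin 2) ℂ) (a : Fin 4) :
    Uᴴ * pauliMat a * U = ∑ u, blochMat U a u • pauliMat u := by
  simp only [blochMat_eq]
  exact eq_sum_pauliMat _

section Unitary

variable {U : Matrix (Fin 2) (Fin 2) ℂ}

theorem conj_conj (hU : U ∈ Matrix.unitaryGroup (Fin 2) ℂ) (A : Matrix (Fin 2) (Fin 2) ℂ) :
    Uᴴ * (U * A * Uᴴ) * U = A := by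
  have h : Uᴴ * U = 1 := Matrix.mem_unitaryGroup_iff'.1 hU
  simp only [mul_assoc, h, mul_one]
  rw [← mul_assoc, h, one_mul]

theorem sum_blochMat_mul (hU : U ∈ Matrix.unitaryGroup (Fin 2) ℂ) (u v : Fin 4) :
    ∑ a, blochMat U a u * blochMat U a v = if u = v then 1 else 0 := by
  have h := trace_pauliMat_mul v u
  rw [← conj_conj hU (pauliMat u), conj_pauliMat] at h
  simp only [Finset.mul_sum, Finset.sum_mul, Matrix.mul_smul, Matrix.smul_mul, Matrix.trace_sum,
    Matrix.trace_smul, smul_eq_mul] at h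
  simp only [blochMat_eq U _ v, mul_div_assoc', ← Finset.sum_div, h, eq_comm (a := u)]
  split_ifs <;> simp

theorem exists_blochMat_ne_zero (hU : U ∈ Matrix.unitaryGroup (Fin 2) ℂ) (u : Fin 4) :
    ∃ a, blochMat U a u ≠ 0 := by
  by_contra! h
  simpa [h] using sum_blochMat_mul hU u u

theorem eq_zero_iff_of_blochMat_ne_zero (hU : U ∈ Matrix.unitaryGroup (Fin 2) ℂ) {a u : Fin 4}
    (h : blochMat U a u ≠ 0) : a = 0 ↔ u = 0 := by
  have h1 : U * Uᴴ = 1 := Matrix.mem_unitaryGroup_iff.1 hU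
  have h2 : Uᴴ * U = 1 := Matrix.mem_unitaryGroup_iff'.1 hU
  have h0 : pauliMat 0 = 1 := rfl
  constructor
  · rintro rfl
    by_contra hu
    apply h
    rw [blochMat_eq, h0, mul_one, h2, ← h0, trace_pauliMat_mul, if_neg hu, zero_div]
  · rintro rfl
    by_contra ha
    apply h
    rw [blochMat, h0, mul_one, h1, ← h0, trace_pauliMat_mul, if_neg ha, zero_div]

theorem isClifford_of_blochMat (hU : U ∈ Matrix.unitaryGroup (Fin 2) ℂ)
    (h : ∀ v, v ≠ 0 → ∀ a b, blochMat U a v ≠ 0 → blochMat U b v ≠ 0 → a = b) :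
    IsClifford U := by
  have hex : ∀ u : Fin 3, ∃ a : Fin 3, blochMat U a.succ u.succ ≠ 0 := by
    intro u
    obtain ⟨a, ha⟩ := exists_blochMat_ne_zero hU u.succ
    obtain ⟨b, rfl⟩ := Fin.exists_succ_eq.2
      (mt (eq_zero_iff_of_blochMat_ne_zero hU ha).1 (Fin.succ_ne_zero u))
    exact ⟨b, ha⟩
  choose g hg using hex
  have hz : ∀ u a, a ≠ (g u).succ → blochMat U a u.succ = 0 := by
    intro u a ha
    by_contra hne
    exact ha (h _ (Fin.succ_ne_zero u) _ _ hne (hg u))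
  have hsum : ∀ u v, blochMat U (g u).succ u.succ * blochMat U (g u).succ v.succ =
      if u = v then 1 else 0 := by
    intro u v
    rw [← Finset.sum_eq_single (f := fun a => blochMat U a u.succ * blochMat U a v.succ)
      (s := Finset.univ) (g u).succ (fun a _ ha => by rw [hz u a ha, zero_mul]) (by simp),
      sum_blochMat_mul hU]
    simp
  have hinj : Function.Injective g := by
    intro u v huv
    by_contra hne
    have h1 := hsum u v
    rw [if_neg hne] at h1
    refine mul_ne_zero (hg u) ?_ h1
    rw [huv]
    exact hg v
  refine ⟨hU, Equiv.ofBijective g (Finite.injective_iff_bijective.1 hinj), fun u =>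
    ⟨blochMat U (g u).succ u.succ, ?_, ?_⟩⟩
  · have := hsum u u
    rw [if_pos rfl] at this
    exact mul_self_eq_one_iff.1 this
  · rw [conj_pauliMat, Finset.sum_eq_single (g u).succ (fun a _ ha => by rw [hz u a ha, zero_smul])
      (by simp)]
    rfl

end Unitary

theorem eq_of_labelSupport_eq {S : Stabilizer ι} {ψ : (ι → Fin 2) → ℂ} (hψ : stabilizesState S ψ)
    {ω : Finset ι}
    (hmin : ∀ Q, pauliExp ψ Q ≠ 0 → labelSupport Q ⊂ ω → labelSupport Q = ∅)
    {P Q : ι → Fin 4} (hP : pauliExp ψ P ≠ 0) (hQ : pauliExp ψ Q ≠ 0)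
    (hPω : labelSupport P = ω) (hQω : labelSupport Q = ω) {j : ι} (hj : j ∈ ω)
    (hPQ : P j = Q j) : P = Q := by
  have h0 : ∀ a b : Fin 4, a ^^^ b = 0 ↔ a = b := by decide
  have hss : labelSupport (fun i => P i ^^^ Q i) ⊂ ω := by
    rw [Finset.ssubset_iff_of_subset]
    · exact ⟨j, hj, by simp [mem_labelSupport, hPQ]⟩
    · intro i hi
      by_contra hiω
      have h1 : P i = 0 := by
        by_contra h
        exact hiω (hPω ▸ mem_labelSupport.2 h)
      have h2 : Q i = 0 := by
        by_contra h
        exact hiω (hQω ▸ mem_labelSupport.2 h)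
      exact mem_labelSupport.1 hi ((h0 _ _).2 (h1.trans h2.symm))
  have h := hmin _ (pauliExp_xor_ne_zero hψ hP hQ) hss
  ext1 i
  by_contra hi
  have : i ∈ labelSupport (fun i => P i ^^^ Q i) := mem_labelSupport.2 (mt (h0 _ _).1 hi)
  simp [h] at this

section LocalUnitary

variable {U : ι → Matrix (Fin 2) (Fin 2) ℂ}

theorem exists_pauliExp_ne_zero_of_kron (hU : ∀ i, U i ∈ Matrix.unitaryGroup (Fin 2) ℂ)
    {ψ : (ι → Fin 2) → ℂ} {P : ι → Fin 4} (hP : pauliExp (kron U *ᵥ ψ) P ≠ 0) :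
    ∃ Q, pauliExp ψ Q ≠ 0 ∧ labelSupport Q = labelSupport P := by
  rw [pauliExp, expVal_kron_mulVec, expVal_eq_sum_pauliExp ψ _ (fun i => blochMat (U i) (P i))
    fun i => conjTranspose_conj_pauliMat _ _] at hP
  obtain ⟨Q, _, hQ⟩ := Finset.exists_ne_zero_of_sum_ne_zero hP
  refine ⟨Q, right_ne_zero_of_mul hQ, ?_⟩
  ext i
  have h := Finset.prod_ne_zero_iff.1 (left_ne_zero_of_mul hQ) i (Finset.mem_univ i)
  rw [mem_labelSupport, mem_labelSupport, not_iff_not,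
    eq_zero_iff_of_blochMat_ne_zero (hU i) h]

/-- If `σ_a` at qubit `i` and `σ_b` at qubit `j` both overlap with the image of `Q` under `U`, then
some Pauli string of the transformed state restricts to `σ_a` and `σ_b` there. -/
theorem exists_pauliExp_ne_zero_with (hU : ∀ i, U i ∈ Matrix.unitaryGroup (Fin 2) ℂ)
    {S : Stabilizer ι} {ψ : (ι → Fin 2) → ℂ} (hψ : stabilizesState S ψ) {ω : Finset ι}
    (hmin : ∀ Q, pauliExp ψ Q ≠ 0 → labelSupport Q ⊂ ω → labelSupport Q = ∅)
    {Q : ι → Fin 4} (hQ : pauliExp ψ Q ≠ 0) (hQω : labelSupport Q = ω) {i j l : ι}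
    (hi : i ∈ ω) (hj : j ∈ ω) (hl : l ∈ ω) (hij : i ≠ j) (hli : l ≠ i) (hlj : l ≠ j) {a b : Fin 4}
    (ha : blochMat (U i) a (Q i) ≠ 0) (hb : blochMat (U j) b (Q j) ≠ 0) :
    ∃ P, pauliExp (kron U *ᵥ ψ) P ≠ 0 ∧ labelSupport P = ω ∧ P i = a ∧ P j = b := by
  set w : ι → Fin 4 → ℂ := fun k p =>
    if k = i then if p = a then 1 else 0
    else if k = j then if p = b then 1 else 0
    else blochMat (U k) p (Q k) with hw
  set w' : ι → Fin 4 → ℂ := fun k q =>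
    if k = i then blochMat (U i) a q
    else if k = j then blochMat (U j) b q
    else if q = Q k then 1 else 0 with hw'
  have hA : ∀ k, (U k)ᴴ * (∑ p, w k p • pauliMat p) * U k = ∑ q, w' k q • pauliMat q := by
    intro k
    by_cases hki : k = i
    · subst hki
      simp [w, w', ite_smul, conjTranspose_conj_pauliMat]
    by_cases hkj : k = j
    · subst hkj
      simp [w, w', ite_smul, conjTranspose_conj_pauliMat, hki]
    · simp only [w, w', if_neg hki, if_neg hkj, ← conj_pauliMat, conj_conj (hU k)]
      simp
  have hQ0 : ∀ {k}, k ∈ ω → Q k ≠ 0 := fun hk => mem_labelSupport.1 (hQω ▸ hk)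
  have ha0 : a ≠ 0 := mt (eq_zero_iff_of_blochMat_ne_zero (hU i) ha).1 (hQ0 hi)
  have hb0 : b ≠ 0 := mt (eq_zero_iff_of_blochMat_ne_zero (hU j) hb).1 (hQ0 hj)
  have hne : expVal (kron U *ᵥ ψ) (fun k => ∑ p, w k p • pauliMat p) ≠ 0 := by
    rw [expVal_kron_mulVec, expVal_eq_sum_pauliExp ψ _ w' hA, Finset.sum_eq_single Q]
    · refine mul_ne_zero (Finset.prod_ne_zero_iff.2 fun k _ => ?_) hQ
      by_cases hki : k = i
      · subst hki
        simpa [w'] using ha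
      by_cases hkj : k = j
      · subst hkj
        simpa [w', hki] using hb
      · simp [w', hki, hkj]
    · intro Q' _ hne
      by_contra h0
      have hprod := fun k => Finset.prod_ne_zero_iff.1 (left_ne_zero_of_mul h0) k (Finset.mem_univ k)
      have hoff : ∀ k, k ≠ i → k ≠ j → Q' k = Q k := by
        intro k hki hkj
        have := hprod k
        simp only [w', if_neg hki, if_neg hkj] at this
        by_contra h
        exact this (if_neg h)
      refine hne (eq_of_labelSupport_eq hψ hmin (right_ne_zero_of_mul h0) hQ ?_ hQω hl
        (hoff l hli hlj))
      ext k
      rw [mem_labelSupport]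
      by_cases hki : k = i
      · subst hki
        have := hprod k
        simp only [w', if_true] at this
        simp [hi, mt (eq_zero_iff_of_blochMat_ne_zero (hU k) this).2 ha0]
      by_cases hkj : k = j
      · subst hkj
        have := hprod k
        simp only [w', if_neg hki, if_true] at this
        simp [hj, mt (eq_zero_iff_of_blochMat_ne_zero (hU k) this).2 hb0]
      · rw [hoff k hki hkj, ← hQω, mem_labelSupport]
    · simp
  rw [expVal_eq_sum_pauliExp _ _ w fun _ => rfl] at hne
  obtain ⟨P, _, hP⟩ := Finset.exists_ne_zero_of_sum_ne_zero hne
  have hprod := fun k => Finset.prod_ne_zero_iff.1 (left_ne_zero_of_mul hP) k (Finset.mem_univ k)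
  have hPi : P i = a := by
    by_contra h
    exact hprod i (by simp [w, h])
  have hPj : P j = b := by
    by_contra h
    exact hprod j (by simp [w, h, hij.symm])
  refine ⟨P, right_ne_zero_of_mul hP, ?_, hPi, hPj⟩
  ext k
  rw [mem_labelSupport]
  by_cases hki : k = i
  · subst hki
    simp [hi, hPi, ha0]
  by_cases hkj : k = j
  · subst hkj
    simp [hj, hPj, hb0]
  · have := hprod k
    simp only [w, if_neg hki, if_neg hkj] at this
    rw [← hQω, mem_labelSupport, not_iff_not, eq_zero_iff_of_blochMat_ne_zero (hU k) this]

end LocalUnitary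

section MinimalSupport

variable {S : Stabilizer ι} {ψ : (ι → Fin 2) → ℂ} {ω : Finset ι}

theorem IsMinimalSupport.labelSupport_eq_empty (hψ : stabilizesState S ψ)
    (hω : IsMinimalSupport S ω) (Q : ι → Fin 4) (hQ : pauliExp ψ Q ≠ 0)
    (hss : labelSupport Q ⊂ ω) : labelSupport Q = ∅ := by
  obtain ⟨M, hM, rfl⟩ := exists_mem_of_pauliExp_ne_zero hψ hQ
  exact hω.2 M hM hss

theorem card_image_label (hψ : stabilizesState S ψ) (ω : Finset ι) :
    ((S.elems.filter fun M => M.support = ω).image PauliOp.label).card = Aomega S ω :=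
  Finset.card_image_of_injOn ((injOn_label hψ).mono (Finset.coe_subset.2 (Finset.filter_subset _ _)))

theorem of_mem_image_label (hψ : stabilizesState S ψ) {Q : ι → Fin 4}
    (hQ : Q ∈ (S.elems.filter fun M => M.support = ω).image PauliOp.label) :
    Complex.normSq (pauliExp ψ Q) = 1 ∧ labelSupport Q = ω := by
  obtain ⟨M, hM, rfl⟩ := Finset.mem_image.1 hQ
  rw [Finset.mem_filter] at hM
  exact ⟨normSq_pauliExp hψ hM.1, hM.2⟩

theorem pauliExp_zero (hψ : stabilizesState S ψ) : pauliExp ψ 0 = 1 := by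
  have h : (fun i : ι => pauliMat ((0 : ι → Fin 4) i)) = fun _ => 1 := rfl
  rw [pauliExp, h, expVal, kron_one, Matrix.one_mulVec, star_dotProduct_self hψ]

theorem three_le_card_of_Aomega (hn : 3 ≤ Fintype.card ι) (hψ : stabilizesState S ψ)
    (hent : FullyEntangled ψ) (hω0 : ω ≠ ∅) (hA : Aomega S ω = 3) : 3 ≤ ω.card := by
  by_contra! hlt
  have hω1 : ω ≠ Finset.univ := by
    rintro rfl
    rw [Finset.card_univ] at hlt
    omega
  set L := (S.elems.filter fun M => M.support = ω).image PauliOp.label with hL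
  have h0 : (0 : ι → Fin 4) ∉ L := by
    intro h
    apply hω0
    rw [← (of_mem_image_label hψ h).2]
    ext i
    simp [mem_labelSupport]
  have hsub : insert 0 L ⊆ Finset.univ.filter fun Q : ι → Fin 4 => ∀ l, l ∉ ω → Q l = 0 := by
    intro Q hQ
    rw [Finset.mem_filter]
    refine ⟨Finset.mem_univ _, fun l hl => ?_⟩
    rcases Finset.mem_insert.1 hQ with rfl | hQ
    · rfl
    · by_contra h
      exact hl ((of_mem_image_label hψ hQ).2 ▸ mem_labelSupport.2 h)
  have h1 := Finset.sum_le_sum_of_subset_of_nonneg hsub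
    fun Q _ _ => Complex.normSq_nonneg (pauliExp ψ Q)
  rw [Finset.sum_insert h0, Finset.sum_congr rfl fun Q hQ => (of_mem_image_label hψ hQ).1,
    pauliExp_zero hψ, Finset.sum_const, card_image_label hψ, hA] at h1
  have h2 := hent.sum_normSq_pauliExp_lt hψ.1 hω0 hω1
  have h3 : (2 : ℝ) ^ ω.card ≤ 2 ^ 2 := pow_le_pow_right₀ one_le_two (by omega)
  norm_num at h1 h3
  linarith

theorem exists_pauliExp_ne_zero_eq (hψ : stabilizesState S ψ) (hω : IsMinimalSupport S ω)
    (hA : Aomega S ω = 3) {i : ι} (hi : i ∈ ω) {v : Fin 4} (hv : v ≠ 0) :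
    ∃ Q, pauliExp ψ Q ≠ 0 ∧ labelSupport Q = ω ∧ Q i = v := by
  set L := (S.elems.filter fun M => M.support = ω).image PauliOp.label with hL
  have hne : ∀ Q ∈ L, pauliExp ψ Q ≠ 0 := fun Q hQ h => by
    simpa [h] using (of_mem_image_label hψ hQ).1
  have hinj : Set.InjOn (fun Q : ι → Fin 4 => Q i) (L : Set (ι → Fin 4)) :=
    fun P hP Q hQ h => eq_of_labelSupport_eq hψ (hω.labelSupport_eq_empty hψ) (hne P hP) (hne Q hQ)
      (of_mem_image_label hψ hP).2 (of_mem_image_label hψ hQ).2 hi h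
  have hsub : L.image (fun Q => Q i) ⊆ Finset.univ.erase 0 := by
    intro u hu
    obtain ⟨Q, hQ, rfl⟩ := Finset.mem_image.1 hu
    exact Finset.mem_erase.2
      ⟨mem_labelSupport.1 ((of_mem_image_label hψ hQ).2.symm ▸ hi), Finset.mem_univ _⟩
  have heq := Finset.eq_of_subset_of_card_le hsub (by
    rw [Finset.card_image_of_injOn hinj, card_image_label hψ, hA]
    simp)
  have hvm : v ∈ L.image (fun Q => Q i) := by
    rw [heq]
    simp [hv]
  obtain ⟨Q, hQ, rfl⟩ := Finset.mem_image.1 hvm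
  exact ⟨Q, hne Q hQ, (of_mem_image_label hψ hQ).2, rfl⟩

end MinimalSupport

end Auxiliary

/-- Let `ψ` be a fully entangled stabilizer state on `n ≥ 3` qubits such
that the minimal supports `ω` with `A_ω(ψ) = 3` cover all qubits. Then `LU(ψ) = LC(ψ)`. -/
theorem stmt_6 {n : ℕ} (hn : 3 ≤ n) (S : Stabilizer (Fin n)) (ψ : (Fin n → Fin 2) → ℂ)
    (hψ : stabilizesState S ψ) (hent : FullyEntangled ψ)
    (hcover : ∀ i : Fin n, ∃ ω : Finset (Fin n),
      IsMinimalSupport S ω ∧ Aomega S ω = 3 ∧ i ∈ ω) :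
    ∀ φ : (Fin n → Fin 2) → ℂ, IsStabilizerState φ → (LUequiv ψ φ ↔ LCequiv ψ φ) := by
  rintro φ ⟨S', hφ⟩
  refine ⟨?_, fun ⟨U, hU, h⟩ => ⟨U, fun i => (hU i).1, h⟩⟩
  rintro ⟨U, hU, rfl⟩
  refine ⟨U, fun i => isClifford_of_blochMat (hU i) fun v hv a a' ha ha' => ?_, rfl⟩
  obtain ⟨ω, hω, hA, hi⟩ := hcover i
  have hmin := hω.labelSupport_eq_empty hψ
  have hmin' : ∀ P, pauliExp (kron U *ᵥ ψ) P ≠ 0 → labelSupport P ⊂ ω → labelSupport P = ∅ := by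
    intro P hP hss
    obtain ⟨Q, hQ, hQP⟩ := exists_pauliExp_ne_zero_of_kron hU hP
    exact hQP ▸ hmin Q hQ (hQP ▸ hss)
  have hcard : 3 ≤ ω.card :=
    three_le_card_of_Aomega (by simpa using hn) hψ hent (Finset.ne_empty_of_mem hi) hA
  obtain ⟨j, hj⟩ : ((ω.erase i)).Nonempty := by
    rw [← Finset.card_pos, Finset.card_erase_of_mem hi]
    omega
  obtain ⟨l, hl⟩ : ((ω.erase i).erase j).Nonempty := by
    rw [← Finset.card_pos, Finset.card_erase_of_mem hj, Finset.card_erase_of_mem hi]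
    omega
  simp only [Finset.mem_erase] at hj hl
  obtain ⟨Q, hQ, hQω, rfl⟩ := exists_pauliExp_ne_zero_eq hψ hω hA hi hv
  obtain ⟨b, hb⟩ := exists_blochMat_ne_zero (hU j) (Q j)
  obtain ⟨P, hP, hPω, rfl, hPj⟩ := exists_pauliExp_ne_zero_with hU hψ hmin hQ hQω hi hj.2 hl.2.2
    hj.1.symm hl.2.1 hl.1 ha hb
  obtain ⟨P', hP', hPω', rfl, hPj'⟩ := exists_pauliExp_ne_zero_with hU hψ hmin hQ hQω hi hj.2 hl.2.2
    hj.1.symm hl.2.1 hl.1 ha' hb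
  rw [eq_of_labelSupport_eq hφ hmin' hP hP' hPω hPω' hj.2 (hPj.trans hPj'.symm)]
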